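/- arXiv:1303.0735 — 6 statements merged into one kernel-verified Lean document; each statement's English description precedes it below -/
import Mathlib

section
/- Let m_i, m_j, m_k be three distinct members of a minimal generating set of a monomial ideal I of R. If m_k strongly divides m_{ij}, then m_{ik} strictly divides m_{ij} and m_{jk} strictly divides m_{ij}. -/
open MvPolynomial

noncomputable section

/-- The trivariate polynomial ring `K[x,y,z]`, with variables indexed by `Fin 3`. -/
abbrev PR (K : Type*) [Field K] : Type _ := MvPolynomial (Fin 3) K

/-- The monomial of `K[x,y,z]` with exponent vector `a : Fin 3 → ℕ`. -/
noncomputable def monom (K : Type*) [Field K] (a : Fin 3 → ℕ) : PR K :=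
  ∏ t, X t ^ a t

/-- `m 0, …, m (n-1)` (given by their exponent vectors) form a minimal generating set of the
monomial ideal they generate: they are pairwise distinct and no one divides another.
(Divisibility of monomials is pointwise `≤` of exponent vectors, so non-divisibility for all
pairs of distinct indices already implies distinctness.) -/
def MinGen {n : ℕ} (m : Fin n → Fin 3 → ℕ) : Prop :=
  ∀ i j, i ≠ j → ¬ m i ≤ m j

/-- Strict divisibility of monomials, in terms of exponent vectors: `a` divides `b` and `a ≠ b`. -/
def strictDvd (a b : Fin 3 → ℕ) : Prop := a ≤ b ∧ a ≠ b

/-- Strong divisibility of monomials: `a` divides `b / x_t` for every variable `x_t`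
dividing `b`. -/
def strongDvd (a b : Fin 3 → ℕ) : Prop :=
  ∀ t, 0 < b t → a ≤ b - Pi.single t 1

/-- A monomial ideal (given by the exponent vectors of its minimal generators) is generic if
whenever two distinct minimal generators have the same positive exponent in some variable,
a third minimal generator strongly divides their lcm. -/
def GenericI {n : ℕ} (m : Fin n → Fin 3 → ℕ) : Prop :=
  ∀ i j, i ≠ j → (∃ t, 0 < m i t ∧ m i t = m j t) →
    ∃ l, l ≠ i ∧ l ≠ j ∧ strongDvd (m l) (m i ⊔ m j)

/-- The homogeneous maximal ideal `𝔪 = (x,y,z)` of `K[x,y,z]`. -/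
noncomputable def mxIdeal (K : Type*) [Field K] : Ideal (PR K) :=
  Ideal.span (Set.range X)

/-- The `R`-linear map `f₁ : Rⁿ → R` sending the `i`-th standard basis vector to the
monomial `m_i`. -/
noncomputable def syzF1 (K : Type*) [Field K] {n : ℕ} (m : Fin n → Fin 3 → ℕ) :
    (Fin n → PR K) →ₗ[PR K] PR K where
  toFun v := ∑ i, v i * monom K (m i)
  map_add' u v := by simp [add_mul, Finset.sum_add_distrib]
  map_smul' c v := by simp [Finset.mul_sum, mul_assoc]

/-- The module `Z₂ = ker f₁` of second syzygies of `R/I`. -/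
noncomputable def Z2 (K : Type*) [Field K] {n : ℕ} (m : Fin n → Fin 3 → ℕ) :
    Submodule (PR K) (Fin n → PR K) :=
  LinearMap.ker (syzF1 K m)

/-- The S-pair `σ_{ij} = (m_{ij}/m_j)·e_j − (m_{ij}/m_i)·e_i ∈ Rⁿ`. -/
noncomputable def sigmaS (K : Type*) [Field K] {n : ℕ} (m : Fin n → Fin 3 → ℕ)
    (i j : Fin n) : Fin n → PR K :=
  Pi.single j (monom K ((m i ⊔ m j) - m j)) - Pi.single i (monom K ((m i ⊔ m j) - m i))

/-- `τ_{ijl} = (m_{ijl}/m_{ij})·e_{ij} − (m_{ijl}/m_{il})·e_{il} + (m_{ijl}/m_{jl})·e_{jl}`,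
an element of the free module `F₂` with basis `e_{pq}` indexed by pairs. -/
noncomputable def tauS (K : Type*) [Field K] {n : ℕ} (m : Fin n → Fin 3 → ℕ)
    (i j l : Fin n) : Fin n × Fin n → PR K :=
  Pi.single (i, j) (monom K ((m i ⊔ m j ⊔ m l) - (m i ⊔ m j)))
    - Pi.single (i, l) (monom K ((m i ⊔ m j ⊔ m l) - (m i ⊔ m l)))
    + Pi.single (j, l) (monom K ((m i ⊔ m j ⊔ m l) - (m j ⊔ m l)))

/-- The submodule `Z₃` of `F₂` generated by all `τ_{abc}` with `a < b < c`. -/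
noncomputable def Z3 (K : Type*) [Field K] {n : ℕ} (m : Fin n → Fin 3 → ℕ) :
    Submodule (PR K) (Fin n × Fin n → PR K) :=
  Submodule.span (PR K) {v | ∃ a b c : Fin n, a < b ∧ b < c ∧ v = tauS K m a b c}

/-- If `c` strongly divides `[a, b]` and `a` does not divide `b`, then `[b, c]` strictly
divides `[a, b]`. -/
theorem strongDvd.strictDvd_sup_right {a b c : Fin 3 → ℕ} (h : strongDvd c (a ⊔ b))
    (hab : ¬ a ≤ b) : strictDvd (b ⊔ c) (a ⊔ b) := by
  obtain ⟨t, ht⟩ : ∃ t, b t < a t := by simpa [Pi.le_def] using hab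
  have hc : c ≤ (a ⊔ b) - Pi.single t 1 := h t (by simp; omega)
  refine ⟨sup_le le_sup_right (hc.trans tsub_le_self), fun he => ?_⟩
  have hct := hc t
  have het := congrFun he t
  simp only [Pi.sub_apply, Pi.sup_apply, Pi.single_eq_same] at hct het
  omega

/-- For distinct members `m i, m j, m l` of a minimal generating set, if
`m_l` strongly divides `m_{ij}` then `m_{il}` and `m_{jl}` both strictly divide `m_{ij}`. -/
theorem stmt2 {n : ℕ} (m : Fin n → Fin 3 → ℕ) (hm : MinGen m)
    (i j l : Fin n) (hij : i ≠ j) (hil : i ≠ l) (hjl : j ≠ l)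
    (h : strongDvd (m l) (m i ⊔ m j)) :
    strictDvd (m i ⊔ m l) (m i ⊔ m j) ∧ strictDvd (m j ⊔ m l) (m i ⊔ m j) := by
  refine ⟨?_, h.strictDvd_sup_right (hm i j hij)⟩
  rw [sup_comm (m i) (m j)] at h ⊢
  exact h.strictDvd_sup_right (hm j i hij.symm)
end
end

section
/- Let m_1,…,m_n be a minimal generating set of a monomial ideal I of R and let 1 ≤ i < j ≤ n. If σ_{ij} ∈ 𝔪Z₂, then there exists an index k with k ≠ i and k ≠ j such that m_{ik} strictly divides m_{ij}. -/
open MvPolynomial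

noncomputable section

theorem monom_eq_monomial (K : Type*) [Field K] (a : Fin 3 → ℕ) :
    monom K a = monomial (Finsupp.equivFunOnFinite.symm a) 1 := by
  rw [monomial_eq, Finsupp.prod_fintype _ _ (fun _ => pow_zero _)]
  simp [monom]

/-- The coefficient at `x^d` of component `i` of a second syzygy vanishes when no generator other
than `m i` divides `x^d · m i`. -/
theorem coeff_eq_zero_of_mem_Z2 (K : Type*) [Field K] {n : ℕ} (m : Fin n → Fin 3 → ℕ)
    {z : Fin n → PR K} (hz : z ∈ Z2 K m) (i : Fin n) (d : Fin 3 →₀ ℕ)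
    (hd : ∀ l, l ≠ i → ¬ m l ≤ m i + d) : coeff d (z i) = 0 := by
  have hsum : ∑ l, z l * monom K (m l) = 0 := hz
  have hc := congrArg (coeff (d + Finsupp.equivFunOnFinite.symm (m i))) hsum
  rw [coeff_sum, Finset.sum_eq_single i, monom_eq_monomial, coeff_mul_monomial] at hc
  · simpa using hc
  · intro l _ hl
    rw [monom_eq_monomial, coeff_mul_monomial', if_neg]
    intro hle
    refine hd l hl fun t => ?_
    simpa [add_comm] using hle t
  · simp

/-- If no generator other than `m i` divides `x^e · m i` for a proper divisor `x^e` of `x^d`, then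
every element of `𝔪 Z₂` has vanishing coefficient at `x^d` in component `i`. -/
theorem coeff_eq_zero_of_mem_mxIdeal_smul_Z2 (K : Type*) [Field K] {n : ℕ}
    (m : Fin n → Fin 3 → ℕ) (i : Fin n) (d : Fin 3 →₀ ℕ)
    (hd : ∀ e : Fin 3 →₀ ℕ, e < d → ∀ l, l ≠ i → ¬ m l ≤ m i + e)
    {v : Fin n → PR K} (hv : v ∈ mxIdeal K • Z2 K m) : coeff d (v i) = 0 := by
  induction hv using Submodule.smul_induction_on' with
  | smul r hr z hz =>
    induction hr using Submodule.span_induction generalizing z with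
    | mem r hr =>
      obtain ⟨t, rfl⟩ := hr
      rw [Pi.smul_apply, smul_eq_mul, coeff_X_mul']
      split_ifs with ht
      · refine coeff_eq_zero_of_mem_Z2 K m hz i _ (hd _ (lt_of_le_of_ne tsub_le_self ?_))
        intro h
        have := DFunLike.congr_fun h t
        simp at this ht
        omega
      · rfl
    | zero => simp
    | add r s _ _ hr hs =>
      rw [add_smul, Pi.add_apply, coeff_add, hr z hz, hs z hz, add_zero]
    | smul a r _ hr =>
      have := hr (a • z) (Submodule.smul_mem _ a hz)
      rwa [smul_smul, mul_comm] at this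
  | add u _ w _ hu hw => simp [hu, hw]

/-- If `σ_{ij} ∈ 𝔪Z₂` then some `m_{il}` (with `l ≠ i, j`) strictly
divides `m_{ij}`. -/
theorem stmt3 (K : Type*) [Field K] {n : ℕ} (m : Fin n → Fin 3 → ℕ) (hm : MinGen m)
    (i j : Fin n) (hij : i < j)
    (h : sigmaS K m i j ∈ mxIdeal K • Z2 K m) :
    ∃ l, l ≠ i ∧ l ≠ j ∧ strictDvd (m i ⊔ m l) (m i ⊔ m j) := by
  by_contra hno
  have key := coeff_eq_zero_of_mem_mxIdeal_smul_Z2 K m i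
    (Finsupp.equivFunOnFinite.symm ((m i ⊔ m j) - m i)) ?_ h
  · simp [sigmaS, hij.ne, monom_eq_monomial] at key
  · intro e he l hl hle
    have hlt : m i + e < m i ⊔ m j := by
      have he' : (e : Fin 3 → ℕ) < (m i ⊔ m j) - m i := he
      calc m i + e < m i + ((m i ⊔ m j) - m i) := by gcongr
        _ = m i ⊔ m j := add_tsub_cancel_of_le le_sup_left
    have hil : m i ⊔ m l < m i ⊔ m j := (sup_le le_self_add hle).trans_lt hlt
    by_cases hlj : l = j
    · exact hil.ne (by rw [hlj])
    · exact hno ⟨l, hl, hlj, hil.le, hil.ne⟩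
end
end

section
/- Let m_1,…,m_n be a minimal generating set of a monomial ideal I of R and let 1 ≤ i < j ≤ n. If there exists an index k with k ≠ i, k ≠ j such that m_{ik} strictly divides m_{ij} and m_{jk} strictly divides m_{ij}, then σ_{ij} ∈ 𝔪Z₂. -/
open MvPolynomial

noncomputable section

theorem monom_add (K : Type*) [Field K] (a b : Fin 3 → ℕ) :
    monom K (a + b) = monom K a * monom K b := by
  simp [monom, pow_add, Finset.prod_mul_distrib]

theorem monom_sub_mul_monom_sub (K : Type*) [Field K] {a b c : Fin 3 → ℕ}
    (hab : a ≤ b) (hbc : b ≤ c) :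
    monom K (c - b) * monom K (b - a) = monom K (c - a) := by
  rw [← monom_add, tsub_add_tsub_cancel hbc hab]

theorem monom_mem_mxIdeal (K : Type*) [Field K] {a : Fin 3 → ℕ} (ha : a ≠ 0) :
    monom K a ∈ mxIdeal K := by
  obtain ⟨t, ht⟩ := Function.ne_iff.mp ha
  exact Ideal.mem_of_dvd _
    ((dvd_pow_self (X t) ht).trans (Finset.dvd_prod_of_mem _ (Finset.mem_univ t)))
    (Ideal.subset_span (Set.mem_range_self t))

theorem monom_sub_mem_mxIdeal (K : Type*) [Field K] {a b : Fin 3 → ℕ} (h : strictDvd a b) :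
    monom K (b - a) ∈ mxIdeal K :=
  monom_mem_mxIdeal K fun h0 => h.2 (le_antisymm h.1 (tsub_eq_zero_iff_le.mp h0))

theorem sigmaS_mem_Z2 (K : Type*) [Field K] {n : ℕ} (m : Fin n → Fin 3 → ℕ) (i j : Fin n) :
    sigmaS K m i j ∈ Z2 K m := by
  have h (k : Fin n) (c : PR K) : syzF1 K m (Pi.single k c) = c * monom K (m k) := by
    simp [syzF1, Pi.single_apply]
  rw [Z2, LinearMap.mem_ker, sigmaS, map_sub, h, h, ← monom_add, ← monom_add,
    tsub_add_cancel_of_le le_sup_right, tsub_add_cancel_of_le le_sup_left, sub_self]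

/-- An S-pair decomposes through any third generator dividing its lcm. -/
theorem sigmaS_eq_smul_add_smul (K : Type*) [Field K] {n : ℕ} (m : Fin n → Fin 3 → ℕ)
    {i j l : Fin n} (hi : m i ⊔ m l ≤ m i ⊔ m j) (hj : m j ⊔ m l ≤ m i ⊔ m j) :
    sigmaS K m i j = monom K ((m i ⊔ m j) - (m i ⊔ m l)) • sigmaS K m i l +
      monom K ((m i ⊔ m j) - (m j ⊔ m l)) • sigmaS K m l j := by
  simp only [sigmaS, smul_sub, ← Pi.single_smul', smul_eq_mul, sup_comm (m l) (m j)]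
  rw [monom_sub_mul_monom_sub K le_sup_right hi, monom_sub_mul_monom_sub K le_sup_left hi,
    monom_sub_mul_monom_sub K le_sup_left hj, monom_sub_mul_monom_sub K le_sup_right hj]
  abel

/-- If some `m_{il}` and `m_{jl}` (with `l ≠ i, j`) both strictly divide
`m_{ij}`, then `σ_{ij} ∈ 𝔪Z₂`. -/
theorem stmt4 (K : Type*) [Field K] {n : ℕ} (m : Fin n → Fin 3 → ℕ) (hm : MinGen m)
    (i j : Fin n) (hij : i < j) (l : Fin n) (hli : l ≠ i) (hlj : l ≠ j)
    (h1 : strictDvd (m i ⊔ m l) (m i ⊔ m j))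
    (h2 : strictDvd (m j ⊔ m l) (m i ⊔ m j)) :
    sigmaS K m i j ∈ mxIdeal K • Z2 K m := by
  rw [sigmaS_eq_smul_add_smul K m h1.1 h2.1]
  exact add_mem
    (Submodule.smul_mem_smul (monom_sub_mem_mxIdeal K h1) (sigmaS_mem_Z2 K m i l))
    (Submodule.smul_mem_smul (monom_sub_mem_mxIdeal K h2) (sigmaS_mem_Z2 K m l j))
end
end

section
/- Let m_1,…,m_n be a minimal generating set of a monomial ideal I of R and let 1 ≤ i < j < k < l ≤ n be indices such that m_i divides m_{jkl} (equivalently, m_{ijk}, m_{ijl} and m_{ikl} all divide m_{jkl}). Then in F₂ one has the identity (m_{jkl}/m_{ijk})·τ_{ijk} − (m_{jkl}/m_{ijl})·τ_{ijl} + (m_{jkl}/m_{ikl})·τ_{ikl} = τ_{jkl}. -/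
open MvPolynomial

noncomputable section

theorem monom_sub_mul_monom_sub_s12 (K : Type*) [Field K] {u v w : Fin 3 → ℕ}
    (huv : u ≤ v) (hvw : v ≤ w) :
    monom K (w - v) * monom K (v - u) = monom K (w - u) := by
  simp only [monom, ← Finset.prod_mul_distrib, ← pow_add, Pi.sub_apply]
  exact Finset.prod_congr rfl fun t _ => by
    rw [Nat.sub_add_sub_cancel (hvw t) (huv t)]

theorem monom_smul_tauS (K : Type*) [Field K] {n : ℕ} (m : Fin n → Fin 3 → ℕ)
    (i j l : Fin n) {w : Fin 3 → ℕ} (hw : m i ⊔ m j ⊔ m l ≤ w) :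
    monom K (w - (m i ⊔ m j ⊔ m l)) • tauS K m i j l =
      Pi.single (i, j) (monom K (w - (m i ⊔ m j)))
        - Pi.single (i, l) (monom K (w - (m i ⊔ m l)))
        + Pi.single (j, l) (monom K (w - (m j ⊔ m l))) := by
  have hij : m i ⊔ m j ≤ m i ⊔ m j ⊔ m l := le_sup_left
  have hil : m i ⊔ m l ≤ m i ⊔ m j ⊔ m l := sup_le_sup_right le_sup_left _
  have hjl : m j ⊔ m l ≤ m i ⊔ m j ⊔ m l := sup_le_sup_right le_sup_right _
  simp only [tauS, smul_add, smul_sub, ← Pi.single_smul, smul_eq_mul,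
    monom_sub_mul_monom_sub_s12 K hij hw, monom_sub_mul_monom_sub_s12 K hil hw,
    monom_sub_mul_monom_sub_s12 K hjl hw]

/-- For `a < b < c < d` with `m_a` dividing `m_{bcd}`, the identity
`(m_{bcd}/m_{abc})·τ_{abc} − (m_{bcd}/m_{abd})·τ_{abd} + (m_{bcd}/m_{acd})·τ_{acd} = τ_{bcd}`
holds in `F₂`. -/
theorem stmt12 (K : Type*) [Field K] {n : ℕ} (m : Fin n → Fin 3 → ℕ) (hm : MinGen m)
    (a b c d : Fin n) (hab : a < b) (hbc : b < c) (hcd : c < d)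
    (h : m a ≤ m b ⊔ m c ⊔ m d) :
    monom K ((m b ⊔ m c ⊔ m d) - (m a ⊔ m b ⊔ m c)) • tauS K m a b c
      - monom K ((m b ⊔ m c ⊔ m d) - (m a ⊔ m b ⊔ m d)) • tauS K m a b d
      + monom K ((m b ⊔ m c ⊔ m d) - (m a ⊔ m c ⊔ m d)) • tauS K m a c d
      = tauS K m b c d := by
  have hb : m b ≤ m b ⊔ m c ⊔ m d := le_sup_left.trans le_sup_left
  have hc : m c ≤ m b ⊔ m c ⊔ m d := le_sup_right.trans le_sup_left
  have hd : m d ≤ m b ⊔ m c ⊔ m d := le_sup_right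
  rw [monom_smul_tauS K m a b c (sup_le (sup_le h hb) hc),
    monom_smul_tauS K m a b d (sup_le (sup_le h hb) hd),
    monom_smul_tauS K m a c d (sup_le (sup_le h hc) hd), tauS]
  abel
end
end

section
/- Let m_1,…,m_n be a minimal generating set of a monomial ideal I of R and let 1 ≤ i < j < k < l ≤ n be indices such that m_{ijk}, m_{ijl} and m_{ikl} all strictly divide m_{jkl}. Then τ_{jkl} ∈ 𝔪Z₃. -/
open MvPolynomial

noncomputable section

/-- A multiple of `τ_{ijl}` by a monomial, with the coefficients collected. -/
theorem monom_sub_smul_tauS (K : Type*) [Field K] {n : ℕ} (m : Fin n → Fin 3 → ℕ)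
    (i j l : Fin n) {u : Fin 3 → ℕ} (hu : m i ⊔ m j ⊔ m l ≤ u) :
    monom K (u - (m i ⊔ m j ⊔ m l)) • tauS K m i j l =
      Pi.single (i, j) (monom K (u - (m i ⊔ m j)))
        - Pi.single (i, l) (monom K (u - (m i ⊔ m l)))
        + Pi.single (j, l) (monom K (u - (m j ⊔ m l))) := by
  rw [tauS, smul_add, smul_sub, ← Pi.single_smul, ← Pi.single_smul, ← Pi.single_smul,
    smul_eq_mul, smul_eq_mul, smul_eq_mul,
    monom_sub_mul_monom_sub K le_sup_left hu,
    monom_sub_mul_monom_sub K (sup_le_sup_right le_sup_left _) hu,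
    monom_sub_mul_monom_sub K (sup_le_sup_right le_sup_right _) hu]

/-- If `m_{abc}`, `m_{abd}` and `m_{acd}` all strictly divide `m_{bcd}`
(for `a < b < c < d`), then `τ_{bcd} ∈ 𝔪Z₃`. -/
theorem stmt13 (K : Type*) [Field K] {n : ℕ} (m : Fin n → Fin 3 → ℕ) (hm : MinGen m)
    (a b c d : Fin n) (hab : a < b) (hbc : b < c) (hcd : c < d)
    (h1 : strictDvd (m a ⊔ m b ⊔ m c) (m b ⊔ m c ⊔ m d))
    (h2 : strictDvd (m a ⊔ m b ⊔ m d) (m b ⊔ m c ⊔ m d))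
    (h3 : strictDvd (m a ⊔ m c ⊔ m d) (m b ⊔ m c ⊔ m d)) :
    tauS K m b c d ∈ mxIdeal K • Z3 K m := by
  have key : tauS K m b c d =
      monom K ((m b ⊔ m c ⊔ m d) - (m a ⊔ m c ⊔ m d)) • tauS K m a c d
        - monom K ((m b ⊔ m c ⊔ m d) - (m a ⊔ m b ⊔ m d)) • tauS K m a b d
        + monom K ((m b ⊔ m c ⊔ m d) - (m a ⊔ m b ⊔ m c)) • tauS K m a b c := by
    rw [monom_sub_smul_tauS K m a c d h3.1, monom_sub_smul_tauS K m a b d h2.1,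
      monom_sub_smul_tauS K m a b c h1.1, tauS]
    abel
  have hmem {i j l : Fin n} (hij : i < j) (hjl : j < l) : tauS K m i j l ∈ Z3 K m :=
    Submodule.subset_span ⟨i, j, l, hij, hjl, rfl⟩
  rw [key]
  exact add_mem (sub_mem
    (Submodule.smul_mem_smul (monom_sub_mem_mxIdeal K h3) (hmem (hab.trans hbc) hcd))
    (Submodule.smul_mem_smul (monom_sub_mem_mxIdeal K h2) (hmem hab (hbc.trans hcd))))
    (Submodule.smul_mem_smul (monom_sub_mem_mxIdeal K h1) (hmem hab hbc))
end
end

section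
/- Let m_1,…,m_n be a minimal generating set of a monomial ideal I of R, and suppose that for distinct indices i, j, l the generators are m_i = x^a with a > 0, m_j = y^{b₁}z^{c₁} with b₁ > 0 and c₁ ≥ 0, and m_l = x^{a₁}z^{c₃} with a₁ > 0, c₃ > 0 and c₃ ≤ c₁. Then [m_i, m_l] = x^a z^{c₃} and [m_l, m_j] = x^{a₁}y^{b₁}z^{c₁} both strictly divide [m_i, m_j] = x^a y^{b₁}z^{c₁}, and consequently the S-pair σ associated with the pair {m_i, m_j} lies in 𝔪Z₂. -/
open MvPolynomial

noncomputable section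

/-- If `m_l` divides `m_{ij}`, the S-pair of `m_i, m_j` is a combination of those of
`m_i, m_l` and `m_l, m_j`. -/
theorem sigmaS_eq_add (K : Type*) [Field K] {n : ℕ} (m : Fin n → Fin 3 → ℕ) {i j l : Fin n}
    (hl : m l ≤ m i ⊔ m j) :
    sigmaS K m i j =
      monom K ((m i ⊔ m j) - (m i ⊔ m l)) • sigmaS K m i l
        + monom K ((m i ⊔ m j) - (m l ⊔ m j)) • sigmaS K m l j := by
  have hmul : ∀ {p u v : Fin 3 → ℕ}, p ≤ u → u ≤ v →
      monom K (v - u) * monom K (u - p) = monom K (v - p) := by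
    intro p u v hp hu
    rw [← monom_add, tsub_add_tsub_cancel hu hp]
  have hil : m i ⊔ m l ≤ m i ⊔ m j := sup_le le_sup_left hl
  have hlj : m l ⊔ m j ≤ m i ⊔ m j := sup_le hl le_sup_right
  simp only [sigmaS, smul_sub, ← Pi.single_smul, smul_eq_mul]
  rw [hmul le_sup_right hil, hmul le_sup_left hil, hmul le_sup_right hlj, hmul le_sup_left hlj]
  abel

theorem sigmaS_mem_smul_Z2 (K : Type*) [Field K] {n : ℕ} (m : Fin n → Fin 3 → ℕ)
    {i j l : Fin n} (hil : strictDvd (m i ⊔ m l) (m i ⊔ m j))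
    (hlj : strictDvd (m l ⊔ m j) (m i ⊔ m j)) :
    sigmaS K m i j ∈ mxIdeal K • Z2 K m := by
  have hmem : ∀ {u v : Fin 3 → ℕ}, strictDvd u v → monom K (v - u) ∈ mxIdeal K := fun h =>
    monom_mem_mxIdeal K fun h0 => h.2 (le_antisymm h.1 (tsub_eq_zero_iff_le.mp h0))
  rw [sigmaS_eq_add K m (le_sup_right.trans hil.1)]
  exact add_mem (Submodule.smul_mem_smul (hmem hil) (sigmaS_mem_Z2 K m i l))
    (Submodule.smul_mem_smul (hmem hlj) (sigmaS_mem_Z2 K m l j))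

/-- If `m_i = x^a`, `m_j = y^{b₁}z^{c₁}` and `m_l = x^{a₁}z^{c₃}` (with
`a, b₁, a₁, c₃ > 0`, `c₁ ≥ 0`, `c₃ ≤ c₁`) are minimal generators, then
`[m_i,m_l] = x^a z^{c₃}` and `[m_l,m_j] = x^{a₁}y^{b₁}z^{c₁}` both strictly divide
`[m_i,m_j] = x^a y^{b₁}z^{c₁}`, and consequently the S-pair of `m_i, m_j` lies in `𝔪Z₂`. -/
theorem stmt15 (K : Type*) [Field K] {n : ℕ} (m : Fin n → Fin 3 → ℕ) (hm : MinGen m)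
    (i j l : Fin n) (hij : i ≠ j) (hil : i ≠ l) (hjl : j ≠ l)
    (a b₁ c₁ a₁ c₃ : ℕ) (ha : 0 < a) (hb₁ : 0 < b₁) (ha₁ : 0 < a₁) (hc₃ : 0 < c₃)
    (hc₃c₁ : c₃ ≤ c₁)
    (hmi : m i = ![a, 0, 0]) (hmj : m j = ![0, b₁, c₁]) (hml : m l = ![a₁, 0, c₃]) :
    m i ⊔ m l = ![a, 0, c₃] ∧ m l ⊔ m j = ![a₁, b₁, c₁] ∧ m i ⊔ m j = ![a, b₁, c₁] ∧
      strictDvd (m i ⊔ m l) (m i ⊔ m j) ∧ strictDvd (m l ⊔ m j) (m i ⊔ m j) ∧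
      sigmaS K m i j ∈ mxIdeal K • Z2 K m := by
  have hlt : a₁ < a := by
    by_contra! h
    refine hm i l hil fun t => ?_
    rw [hmi, hml]
    fin_cases t <;> simp [h]
  have h1 : m i ⊔ m l = ![a, 0, c₃] := by
    rw [hmi, hml]
    ext t
    fin_cases t <;> simp [hlt.le]
  have h2 : m l ⊔ m j = ![a₁, b₁, c₁] := by
    rw [hml, hmj]
    ext t
    fin_cases t <;> simp [hc₃c₁]
  have h3 : m i ⊔ m j = ![a, b₁, c₁] := by
    rw [hmi, hmj]
    ext t
    fin_cases t <;> simp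
  have h4 : strictDvd (m i ⊔ m l) (m i ⊔ m j) := by
    rw [h1, h3]
    refine ⟨fun t => ?_, fun h => hb₁.ne (congrFun h 1)⟩
    fin_cases t <;> simp [hc₃c₁]
  have h5 : strictDvd (m l ⊔ m j) (m i ⊔ m j) := by
    rw [h2, h3]
    refine ⟨fun t => ?_, fun h => hlt.ne (congrFun h 0)⟩
    fin_cases t <;> simp [hlt.le]
  exact ⟨h1, h2, h3, h4, h5, sigmaS_mem_smul_Z2 K m h4 h5⟩
end
end
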